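/- arXiv:1112.2389 — 4 statements merged into one kernel-verified Lean document; each statement's English description precedes it below -/
import Mathlib

section
/- There exists a constant ρ* > 0 such that for every ρ ∈ [0, ρ*], every s ∈ ℝ, and every adapted process (D_n) satisfying the drift hypotheses with parameters ρ, Ψ, ε, the hitting time γ satisfies γ < ∞ almost surely and E[γ·e^{Ψγ}] < ∞. -/
open MeasureTheory ProbabilityTheory

/-- `Ψ = 2/η` with `η = 1 − λ`. -/
noncomputable def Psi (lam : ℝ) : ℝ := 2 / (1 - lam)

/-- `ε = ηλ/8` with `η = 1 − λ`. -/
noncomputable def eps (lam : ℝ) : ℝ := (1 - lam) * lam / 8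

/-- The hitting time `γ = inf{n ≥ 0 : D_n ≤ 0}` (as a natural number; on the
event that the process never hits `(−∞,0]` — which is shown to be null — the
infimum of the empty set is `0` by convention). -/
noncomputable def hitTime {Ω : Type} (D : ℕ → Ω → ℝ) (ω : Ω) : ℕ :=
  sInf {n : ℕ | D n ω ≤ 0}

/-- If `A` has conditional probability at least `1 - ρ` given `m`, then weighting by a nonnegative
`m`-measurable function preserves this bound. -/
theorem le_integral_mul_indicator_of_le_condExp {Ω : Type*} {m mΩ : MeasurableSpace Ω}
    {P : Measure Ω} [IsProbabilityMeasure P] (hm : m ≤ mΩ) {W : Ω → ℝ} {A : Set Ω} {ρ : ℝ}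
    (hW0 : ∀ ω, 0 ≤ W ω) (hWm : StronglyMeasurable[m] W) (hWi : Integrable W P)
    (hA : MeasurableSet A)
    (h : ∀ᵐ ω ∂P, 1 - ρ ≤ (P[A.indicator (fun _ => (1 : ℝ)) | m]) ω) :
    (1 - ρ) * ∫ ω, W ω ∂P ≤ ∫ ω, W ω * A.indicator (fun _ => (1 : ℝ)) ω ∂P := by
  have hAi : Integrable (A.indicator fun _ => (1 : ℝ)) P := (integrable_const 1).indicator hA
  have hWA : Integrable (W * A.indicator fun _ => (1 : ℝ)) P := by
    refine hWi.mul_bdd (c := 1) hAi.aestronglyMeasurable (.of_forall fun ω => ?_)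
    by_cases hω : ω ∈ A <;> simp [hω]
  have hpull := condExp_mul_of_stronglyMeasurable_left hWm hWA hAi
  have hcond : ∫ ω, W ω * A.indicator (fun _ => (1 : ℝ)) ω ∂P
      = ∫ ω, (P[W * A.indicator (fun _ => (1 : ℝ)) | m]) ω ∂P :=
    (integral_condExp hm).symm
  rw [hcond, ← integral_const_mul]
  refine integral_mono_ae (hWi.const_mul _) integrable_condExp ?_
  filter_upwards [h, hpull] with ω h1 h2
  rw [h2, Pi.mul_apply, mul_comm]
  exact mul_le_mul_of_nonneg_left h1 (hW0 ω)

/-- One step of the exponential drift bound. -/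
theorem integral_exp_mul_le_of_drift {Ω : Type*} {m mΩ : MeasurableSpace Ω}
    {P : Measure Ω} [IsProbabilityMeasure P] (hm : m ≤ mΩ) {X Y : Ω → ℝ} {ρ a b t : ℝ}
    (ht : 0 ≤ t) (hX : Measurable[m] X) (hY : Measurable Y)
    (hXi : Integrable (fun ω => Real.exp (t * X ω)) P)
    (hb : ∀ᵐ ω ∂P, Y ω ≤ X ω + b)
    (ha : ∀ᵐ ω ∂P, 1 - ρ ≤
      (P[{ω' | Y ω' ≤ X ω' - a}.indicator (fun _ => (1 : ℝ)) | m]) ω) :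
    Integrable (fun ω => Real.exp (t * Y ω)) P ∧
      ∫ ω, Real.exp (t * Y ω) ∂P ≤
        (Real.exp (-(t * a)) + ρ * Real.exp (t * b)) * ∫ ω, Real.exp (t * X ω) ∂P := by
  have hA : MeasurableSet {ω | Y ω ≤ X ω - a} :=
    measurableSet_le hY ((hX.mono hm le_rfl).sub_const a)
  set A := {ω | Y ω ≤ X ω - a}
  set W : Ω → ℝ := fun ω => Real.exp (t * X ω)
  have hYi : Integrable (fun ω => Real.exp (t * Y ω)) P := by
    refine (hXi.const_mul (Real.exp (t * b))).mono'
      (Real.measurable_exp.comp (hY.const_mul t)).aestronglyMeasurable ?_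
    filter_upwards [hb] with ω hω
    rw [Real.norm_eq_abs, Real.abs_exp, ← Real.exp_add]
    exact Real.exp_le_exp.2 (by nlinarith)
  have hWA : Integrable (fun ω => W ω * A.indicator (fun _ => (1 : ℝ)) ω) P := by
    refine hXi.mul_bdd (c := 1) ((measurable_const.indicator hA).aestronglyMeasurable)
      (.of_forall fun ω => ?_)
    by_cases hω : ω ∈ A <;> simp [hω]
  have hWm : StronglyMeasurable[m] W :=
    (Real.measurable_exp.comp (hX.const_mul t)).stronglyMeasurable
  have key := le_integral_mul_indicator_of_le_condExp hm (fun ω => (Real.exp_pos _).le)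
    hWm hXi hA ha
  refine ⟨hYi, ?_⟩
  calc ∫ ω, Real.exp (t * Y ω) ∂P
      ≤ ∫ ω, ((Real.exp (-(t * a)) + Real.exp (t * b)) * W ω
          - Real.exp (t * b) * (W ω * A.indicator (fun _ => (1 : ℝ)) ω)) ∂P := by
        refine integral_mono_ae hYi ((hXi.const_mul _).sub (hWA.const_mul _)) ?_
        filter_upwards [hb] with ω hω
        by_cases hωA : ω ∈ A
        · have h1 : Y ω ≤ X ω - a := hωA
          have h2 : Real.exp (t * Y ω) ≤ Real.exp (-(t * a)) * W ω := by
            rw [← Real.exp_add]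
            exact Real.exp_le_exp.2 (by nlinarith)
          simp only [Set.indicator_of_mem hωA]
          linarith
        · have h2 : Real.exp (t * Y ω) ≤ Real.exp (t * b) * W ω := by
            rw [← Real.exp_add]
            exact Real.exp_le_exp.2 (by nlinarith)
          have h3 : 0 ≤ Real.exp (-(t * a)) * W ω := by positivity
          simp only [Set.indicator_of_notMem hωA]
          linarith
    _ = (Real.exp (-(t * a)) + Real.exp (t * b)) * ∫ ω, W ω ∂P
          - Real.exp (t * b) * ∫ ω, W ω * A.indicator (fun _ => (1 : ℝ)) ω ∂P := by
        rw [integral_sub (hXi.const_mul _) (hWA.const_mul _), integral_const_mul,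
          integral_const_mul]
    _ ≤ _ := by nlinarith [mul_le_mul_of_nonneg_left key (Real.exp_pos (t * b)).le]

/-- Geometric decay of the exponential moments of a process with downward drift. -/
theorem lintegral_exp_mul_le_of_drift {Ω : Type*} {mΩ : MeasurableSpace Ω}
    {P : Measure Ω} [IsProbabilityMeasure P] {ℱ : Filtration ℕ mΩ} {D : ℕ → Ω → ℝ}
    {ρ a b t s : ℝ} (hρ : 0 ≤ ρ) (ht : 0 ≤ t) (hD : Adapted ℱ D)
    (hs : ∀ᵐ ω ∂P, D 0 ω = s)
    (hb : ∀ n : ℕ, ∀ᵐ ω ∂P, D (n + 1) ω ≤ D n ω + b)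
    (ha : ∀ n : ℕ, ∀ᵐ ω ∂P, 1 - ρ ≤
      (P[{ω' | D (n + 1) ω' ≤ D n ω' - a}.indicator (fun _ => (1 : ℝ)) | ℱ n]) ω) (n : ℕ) :
    ∫⁻ ω, ENNReal.ofReal (Real.exp (t * D n ω)) ∂P ≤
      ENNReal.ofReal (Real.exp (t * s) *
        (Real.exp (-(t * a)) + ρ * Real.exp (t * b)) ^ n) := by
  have hint : Integrable (fun ω => Real.exp (t * D n ω)) P ∧
      ∫ ω, Real.exp (t * D n ω) ∂P ≤
        Real.exp (t * s) * (Real.exp (-(t * a)) + ρ * Real.exp (t * b)) ^ n := by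
    induction n with
    | zero =>
      have h0 : (fun ω => Real.exp (t * D 0 ω)) =ᵐ[P] fun _ => Real.exp (t * s) := by
        filter_upwards [hs] with ω hω
        rw [hω]
      exact ⟨(integrable_const _).congr h0.symm, by simp [integral_congr_ae h0]⟩
    | succ n ih =>
      obtain ⟨h1, h2⟩ := integral_exp_mul_le_of_drift (ℱ.le n) ht (hD n)
        ((hD (n + 1)).mono (ℱ.le _) le_rfl) ih.1 (hb n) (ha n)
      refine ⟨h1, h2.trans ?_⟩
      rw [pow_succ', mul_left_comm]
      exact mul_le_mul_of_nonneg_left ih.2 (by positivity)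
  rw [← ofReal_integral_eq_lintegral_ofReal hint.1 (.of_forall fun ω => (Real.exp_pos _).le)]
  exact ENNReal.ofReal_le_ofReal hint.2

theorem ofReal_apply_hitTime_le_tsum {Ω : Type} (D : ℕ → Ω → ℝ) {f : ℕ → ℝ} (hf0 : f 0 = 0)
    {t : ℝ} (ht : 0 ≤ t) (ω : Ω) :
    ENNReal.ofReal (f (hitTime D ω)) ≤
      ∑' n, ENNReal.ofReal (f (n + 1)) * ENNReal.ofReal (Real.exp (t * D n ω)) := by
  rcases h : hitTime D ω with _ | n
  · simp [hf0]
  · refine le_trans ?_ (ENNReal.le_tsum n)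
    have hn : 0 < D n ω :=
      not_le.1 (Nat.notMem_of_lt_sInf (s := {n | D n ω ≤ 0}) (h ▸ n.lt_succ_self : n < hitTime D ω))
    exact le_mul_of_one_le_right' (ENNReal.one_le_ofReal.2 (Real.one_le_exp (by positivity)))

/-- Summable exponential moments force the process to become nonpositive. -/
theorem ae_exists_le_zero_of_tsum_ne_top {Ω : Type*} {mΩ : MeasurableSpace Ω} {P : Measure Ω}
    {D : ℕ → Ω → ℝ} {t : ℝ} (ht : 0 ≤ t) (hD : ∀ n, Measurable (D n))
    (h : ∑' n, ∫⁻ ω, ENNReal.ofReal (Real.exp (t * D n ω)) ∂P ≠ ⊤) :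
    ∀ᵐ ω ∂P, ∃ n, D n ω ≤ 0 := by
  have hm : ∀ n, Measurable fun ω => ENNReal.ofReal (Real.exp (t * D n ω)) := fun n =>
    (Real.measurable_exp.comp ((hD n).const_mul t)).ennreal_ofReal
  rw [← lintegral_tsum fun n => (hm n).aemeasurable] at h
  filter_upwards [ae_lt_top (Measurable.tsum hm) h] with ω hω
  by_contra! hpos
  refine hω.ne (top_unique ?_)
  rw [← ENNReal.tsum_const_eq_top_of_ne_zero (α := ℕ) one_ne_zero]
  exact ENNReal.tsum_le_tsum fun n =>
    ENNReal.one_le_ofReal.2 (Real.one_le_exp (mul_nonneg ht (hpos n).le))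

/-- Fix `λ ∈ (0,1)`, `Ψ = 2/(1−λ)`, `ε = (1−λ)λ/8`.  There exists
`ρ* > 0` such that for every `ρ ∈ [0, ρ*]`, every `s ∈ ℝ`, and every adapted
process `(D_n)` satisfying the drift hypotheses (`D_0 = s` a.s.,
`D_{n+1} ≤ D_n + Ψ` a.s., and `P(D_{n+1} ≤ D_n − ε | F_n) ≥ 1 − ρ` a.s.), the
hitting time `γ = inf{n : D_n ≤ 0}` satisfies `γ < ∞` a.s. and
`E[γ·e^{Ψγ}] < ∞`. -/
theorem stmt2 (lam : ℝ) (hlam0 : 0 < lam) (hlam1 : lam < 1) :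
    ∃ ρstar > (0 : ℝ), ∀ ρ : ℝ, 0 ≤ ρ → ρ ≤ ρstar → ∀ s : ℝ,
    ∀ (Ω : Type) (mΩ : MeasurableSpace Ω) (P : Measure Ω),
      IsProbabilityMeasure P →
    ∀ (ℱ : Filtration ℕ mΩ) (D : ℕ → Ω → ℝ), Adapted ℱ D →
      (∀ᵐ ω ∂P, D 0 ω = s) →
      (∀ n : ℕ, ∀ᵐ ω ∂P, D (n + 1) ω ≤ D n ω + Psi lam) →
      (∀ n : ℕ, ∀ᵐ ω ∂P, 1 - ρ ≤
        (P[{ω' | D (n + 1) ω' ≤ D n ω' - eps lam}.indicator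
            (fun _ => (1 : ℝ)) | ℱ n]) ω) →
      (∀ᵐ ω ∂P, ∃ n : ℕ, D n ω ≤ 0) ∧
      ∫⁻ ω, ENNReal.ofReal
          ((hitTime D ω : ℝ) * Real.exp (Psi lam * (hitTime D ω : ℝ))) ∂P < ⊤ := by
  have hΨ : 0 < Psi lam := div_pos two_pos (by linarith)
  have hε : 0 < eps lam := by unfold eps; nlinarith [mul_pos (sub_pos.2 hlam1) hlam0]
  set t := (Psi lam + 2) / eps lam
  have ht : 0 ≤ t := by positivity
  have hte : t * eps lam = Psi lam + 2 := div_mul_cancel₀ _ hε.ne'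
  refine ⟨Real.exp (-(t * eps lam) - t * Psi lam), Real.exp_pos _, ?_⟩
  intro ρ hρ0 hρ s Ω mΩ P hP ℱ D hD hs hb ha
  have hrate : Real.exp (-(t * eps lam)) + ρ * Real.exp (t * Psi lam)
      ≤ Real.exp (-(Psi lam + 1)) := by
    have h1 : ρ * Real.exp (t * Psi lam) ≤ Real.exp (-(t * eps lam)) := by
      refine (mul_le_mul_of_nonneg_right hρ (Real.exp_pos _).le).trans_eq ?_
      rw [← Real.exp_add, sub_add_cancel]
    have h2 : Real.exp (-(Psi lam + 1)) = Real.exp 1 * Real.exp (-(t * eps lam)) := by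
      rw [← Real.exp_add, hte]
      ring_nf
    nlinarith [Real.add_one_le_exp 1, Real.exp_pos (-(t * eps lam))]
  have hmom (n : ℕ) : ∫⁻ ω, ENNReal.ofReal (Real.exp (t * D n ω)) ∂P ≤
      ENNReal.ofReal (Real.exp (t * s) * Real.exp (-(Psi lam + 1)) ^ n) :=
    (lintegral_exp_mul_le_of_drift hρ0 ht hD hs hb ha n).trans
      (ENNReal.ofReal_le_ofReal (by gcongr))
  have hmeas (n : ℕ) : Measurable (D n) := (hD n).mono (ℱ.le n) le_rfl
  constructor
  · refine ae_exists_le_zero_of_tsum_ne_top ht hmeas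
      (ne_top_of_le_ne_top ?_ (ENNReal.tsum_le_tsum hmom))
    exact ((summable_geometric_of_lt_one (Real.exp_pos _).le
      (Real.exp_lt_one_iff.2 (by linarith))).mul_left _).tsum_ofReal_ne_top
  · set f : ℕ → ℝ := fun n => n * Real.exp (Psi lam * n) with hf
    have hfexp (n : ℕ) : f (n + 1) * (Real.exp (t * s) * Real.exp (-(Psi lam + 1)) ^ n)
        = Real.exp (t * s) * Real.exp (Psi lam + 1) *
          (((n + 1 : ℕ) : ℝ) ^ 1 * Real.exp (-1) ^ (n + 1)) := by
      have h1 : Real.exp (Psi lam * ((n + 1 : ℕ) : ℝ)) * Real.exp (-(Psi lam + 1)) ^ n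
          = Real.exp (Psi lam + 1) * Real.exp (-1) ^ (n + 1) := by
        simp only [← Real.exp_nat_mul, ← Real.exp_add]
        push_cast
        ring_nf
      simp only [hf, pow_one]
      linear_combination ((n + 1 : ℕ) : ℝ) * Real.exp (t * s) * h1
    have hsum : Summable fun n : ℕ =>
        f (n + 1) * (Real.exp (t * s) * Real.exp (-(Psi lam + 1)) ^ n) := by
      simp only [hfexp]
      have hr : ‖Real.exp (-1)‖ < 1 := by
        rw [Real.norm_eq_abs, Real.abs_exp]
        exact Real.exp_lt_one_iff.2 (by norm_num)
      have hg := summable_pow_mul_geometric_of_norm_lt_one 1 hr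
      exact Summable.mul_left _
        ((summable_nat_add_iff (f := fun n : ℕ => (n : ℝ) ^ 1 * Real.exp (-1) ^ n) 1).2 hg)
    calc ∫⁻ ω, ENNReal.ofReal (f (hitTime D ω)) ∂P
        ≤ ∫⁻ ω, ∑' n, ENNReal.ofReal (f (n + 1)) *
            ENNReal.ofReal (Real.exp (t * D n ω)) ∂P :=
          lintegral_mono fun ω => ofReal_apply_hitTime_le_tsum D (by simp [hf]) ht ω
      _ = ∑' n, ENNReal.ofReal (f (n + 1)) *
            ∫⁻ ω, ENNReal.ofReal (Real.exp (t * D n ω)) ∂P := by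
          have hm (n : ℕ) : Measurable fun ω => ENNReal.ofReal (Real.exp (t * D n ω)) :=
            (Real.measurable_exp.comp ((hmeas n).const_mul t)).ennreal_ofReal
          rw [lintegral_tsum fun n => ((hm n).const_mul _).aemeasurable]
          simp only [lintegral_const_mul _ (hm _)]
      _ ≤ ∑' n, ENNReal.ofReal
            (f (n + 1) * (Real.exp (t * s) * Real.exp (-(Psi lam + 1)) ^ n)) := by
          refine ENNReal.tsum_le_tsum fun n => ?_
          have hfn : 0 ≤ f (n + 1) := by positivity
          rw [ENNReal.ofReal_mul hfn]
          exact mul_le_mul_right (hmom n) _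
      _ < ⊤ := hsum.tsum_ofReal_lt_top
end

section
/- Let A, A', N, N', T, M, S, K be nonnegative real numbers and set B = A + 4εN and B' = A' + 4εN'. Assume B > 0, B ≤ N, T = M + S, S ≤ K + δB, A' ≤ A + λT − K + δB, M ≤ δΨB, and N' ≤ N/2 + T. Then T < ΨB and B' ≤ (1 − ε)B. -/
/-- the arithmetic core of the downwards-drift estimate.
Fix `λ ∈ (0,1)`, `η = 1 − λ`, `Ψ = 2/η`, `ε = ηλ/8`, `δ = ε/(2Ψ)`.
Let `A, A', N, N', T, M, S, K` be nonnegative reals, `B = A + 4εN`, `B' = A' + 4εN'`.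
Assume `B > 0`, `B ≤ N`, `T = M + S`, `S ≤ K + δB`, `A' ≤ A + λT − K + δB`,
`M ≤ δΨB`, `N' ≤ N/2 + T`.  Then `T < ΨB` and `B' ≤ (1 − ε)B`. -/
theorem stmt6 (lam η Ψ ε δ : ℝ)
    (hlam0 : 0 < lam) (hlam1 : lam < 1)
    (hη : η = 1 - lam) (hΨ : Ψ = 2 / η) (hε : ε = η * lam / 8) (hδ : δ = ε / (2 * Ψ))
    (A A' N N' T M S K : ℝ)
    (hA : 0 ≤ A) (hA' : 0 ≤ A') (hN : 0 ≤ N) (hN' : 0 ≤ N')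
    (hT0 : 0 ≤ T) (hM0 : 0 ≤ M) (hS0 : 0 ≤ S) (hK0 : 0 ≤ K)
    (B B' : ℝ) (hB : B = A + 4 * ε * N) (hB' : B' = A' + 4 * ε * N')
    (hBpos : 0 < B) (hBN : B ≤ N)
    (hTMS : T = M + S)
    (hS : S ≤ K + δ * B)
    (hA'le : A' ≤ A + lam * T - K + δ * B)
    (hM : M ≤ δ * Ψ * B)
    (hN'le : N' ≤ N / 2 + T) :
    T < Ψ * B ∧ B' ≤ (1 - ε) * B := by
  have hη0 : 0 < η := by linarith
  have hη1 : η < 1 := by linarith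
  have hε0 : 0 < ε := by rw [hε]; positivity
  have hδ' : δ = ε * η / 4 := by rw [hδ, hΨ]; field_simp; norm_num
  have hδΨ : δ * Ψ = ε / 2 := by rw [hδ', hΨ]; field_simp; norm_num
  have hlam : lam = 1 - η := by linarith
  have hεB : 0 < ε * B := mul_pos hε0 hBpos
  have hεηB : ε * η * B ≤ ε * B := by nlinarith
  have hεBN : ε * B ≤ ε * N := mul_le_mul_of_nonneg_left hBN hε0.le
  rw [hδΨ] at hM
  rw [hδ'] at hS hA'le
  have drift : A' ≤ A - η * T + ε * B := by
    rw [hlam] at hA'le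
    linarith
  constructor
  · rw [hΨ, div_mul_eq_mul_div, lt_div_iff₀ hη0]
    linarith
  · have hεη : 4 * ε ≤ η := by rw [hε]; nlinarith
    have hεT : 4 * ε * T ≤ η * T := mul_le_mul_of_nonneg_right hεη hT0
    have hεN' : ε * N' ≤ ε * (N / 2 + T) := mul_le_mul_of_nonneg_left hN'le hε0.le
    linarith
end

section
/- Let u : ℝ/ℤ → ℝ be a function for which there exist a ∈ ℝ and b ∈ [a, a+1] such that the lift ũ : [a, a+1] → ℝ of u (with ũ(x) = u(x mod 1)) is non-decreasing on [a, b] and non-increasing on [b, a+1]. Then for every c ∈ ℝ, the sublevel set {x ∈ ℝ/ℤ : u(x) < c} is a preconnected subset of ℝ/ℤ. -/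
/-- Let `u : ℝ/ℤ → ℝ` be a function for which there exist `a ∈ ℝ` and
`b ∈ [a, a+1]` such that the lift `ũ(x) = u(x mod 1)` of `u` to `[a, a+1]` is
non-decreasing on `[a, b]` and non-increasing on `[b, a+1]`.  Then for every
`c ∈ ℝ`, the sublevel set `{x ∈ ℝ/ℤ : u(x) < c}` is a preconnected subset of the
circle `ℝ/ℤ` (with its quotient topology). -/
theorem stmt7 (u : UnitAddCircle → ℝ) (a b : ℝ)
    (hab : a ≤ b) (hb1 : b ≤ a + 1)
    (hmono : MonotoneOn (fun x : ℝ => u (x : UnitAddCircle)) (Set.Icc a b))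
    (hanti : AntitoneOn (fun x : ℝ => u (x : UnitAddCircle)) (Set.Icc b (a + 1)))
    (c : ℝ) :
    IsPreconnected {x : UnitAddCircle | u x < c} := by
  refine isPreconnected_of_forall (a : UnitAddCircle) fun y hy => ?_
  obtain ⟨x, ⟨hax, hxa⟩, rfl⟩ : ∃ x ∈ Set.Ico a (a + 1), (x : UnitAddCircle) = y := by
    obtain ⟨x, hx⟩ := (AddCircle.equivIco (1 : ℝ) a).symm.surjective y
    exact ⟨x, x.2, hx⟩
  have hcont : Continuous fun t : ℝ => (t : UnitAddCircle) := AddCircle.continuous_mk' 1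
  rcases le_total x b with hxb | hbx
  · refine ⟨(fun t : ℝ => (t : UnitAddCircle)) '' Set.Icc a x, ?_, ⟨a, ⟨le_rfl, hax⟩, rfl⟩,
      ⟨x, ⟨hax, le_rfl⟩, rfl⟩, isPreconnected_Icc.image _ hcont.continuousOn⟩
    rintro _ ⟨t, ⟨hat, htx⟩, rfl⟩
    exact (hmono ⟨hat, htx.trans hxb⟩ ⟨hax, hxb⟩ htx).trans_lt hy
  · refine ⟨(fun t : ℝ => (t : UnitAddCircle)) '' Set.Icc x (a + 1), ?_,
      ⟨a + 1, ⟨hxa.le, le_rfl⟩, AddCircle.coe_add_period 1 a⟩,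
      ⟨x, ⟨le_rfl, hxa.le⟩, rfl⟩, isPreconnected_Icc.image _ hcont.continuousOn⟩
    rintro _ ⟨t, ⟨hxt, hta⟩, rfl⟩
    exact (hanti ⟨hbx, hxa.le⟩ ⟨hbx.trans hxt, hta⟩ hxt).trans_lt hy
end

section
/- There exists a constant ρ* > 0 such that the following holds. Let (D_n) be an adapted process satisfying the drift hypotheses with parameters ρ ≤ ρ*, Ψ, ε and starting point s, let γ = inf{n ≥ 0 : D_n ≤ 0}, let B_* > 0 be a constant, and let (T_n)_{n≥1} be nonnegative random variables on the same probability space with T_n ≤ Ψ·B_*·e^{D_{n−1}} almost surely for every n ≥ 1. Then E[ Σ_{n=1}^{γ} T_n ] < ∞. -/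
open MeasureTheory ProbabilityTheory
open scoped ENNReal

/-- If `A` has conditional probability at least `c` given `m`, then a bounded nonnegative
`m`-measurable function keeps at least the fraction `c` of its integral on `A`. -/
theorem mul_integral_le_integral_mul_indicator {Ω : Type*} {m mΩ : MeasurableSpace Ω}
    {P : Measure Ω} [IsFiniteMeasure P] (hm : m ≤ mΩ) {X : Ω → ℝ}
    (hX : StronglyMeasurable[m] X) (hX0 : ∀ ω, 0 ≤ X ω) {b : ℝ} (hXb : ∀ᵐ ω ∂P, X ω ≤ b)
    {A : Set Ω} (hA : MeasurableSet A) {c : ℝ}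
    (hc : ∀ᵐ ω ∂P, c ≤ (P[A.indicator (fun _ => (1 : ℝ)) | m]) ω) :
    c * ∫ ω, X ω ∂P ≤ ∫ ω, X ω * A.indicator (fun _ => (1 : ℝ)) ω ∂P := by
  have hXn : ∀ᵐ ω ∂P, ‖X ω‖ ≤ b := by
    filter_upwards [hXb] with ω h
    rwa [Real.norm_of_nonneg (hX0 ω)]
  have hXi : Integrable X P := .of_bound (hX.mono hm).aestronglyMeasurable b hXn
  have hpull := condExp_stronglyMeasurable_mul_of_bound hm hX
    ((integrable_const (1 : ℝ)).indicator hA) b hXn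
  calc c * ∫ ω, X ω ∂P = ∫ ω, c * X ω ∂P := (integral_const_mul c X).symm
    _ ≤ ∫ ω, (P[X * A.indicator (fun _ => (1 : ℝ)) | m]) ω ∂P := by
        refine integral_mono_ae (hXi.const_mul c) integrable_condExp ?_
        filter_upwards [hpull, hc] with ω h₁ h₂
        rw [h₁, Pi.mul_apply, mul_comm]
        exact mul_le_mul_of_nonneg_left h₂ (hX0 ω)
    _ = ∫ ω, X ω * A.indicator (fun _ => (1 : ℝ)) ω ∂P := integral_condExp hm

/-- One-step exponential drift: if `Y ≤ X + a` and, conditionally on `m`, `Y ≤ X - e` with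
probability at least `1 - ρ`, then `exp Y` has mean at most `exp (-e) + exp a * ρ` times that
of `exp X`. -/
theorem integral_exp_le_of_condExp_drift {Ω : Type*} {m mΩ : MeasurableSpace Ω}
    {P : Measure Ω} [IsFiniteMeasure P] (hm : m ≤ mΩ) {X Y : Ω → ℝ}
    (hX : Measurable[m] X) (hY : Measurable Y) {a b e ρ : ℝ} (hXb : ∀ᵐ ω ∂P, X ω ≤ b)
    (hYX : ∀ᵐ ω ∂P, Y ω ≤ X ω + a)
    (hdrift : ∀ᵐ ω ∂P, 1 - ρ ≤
      (P[{ω' | Y ω' ≤ X ω' - e}.indicator (fun _ => (1 : ℝ)) | m]) ω) :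
    ∫ ω, Real.exp (Y ω) ∂P ≤
      (Real.exp (-e) + Real.exp a * ρ) * ∫ ω, Real.exp (X ω) ∂P := by
  set A := {ω' | Y ω' ≤ X ω' - e}
  have hX' : Measurable X := hX.mono hm le_rfl
  have hA : MeasurableSet A := measurableSet_le hY (hX'.sub_const e)
  have hbd : ∀ᵐ ω ∂P, Real.exp (X ω) ≤ Real.exp b := by
    filter_upwards [hXb] with ω h using Real.exp_le_exp.2 h
  have key := mul_integral_le_integral_mul_indicator hm
    (Real.measurable_exp.comp hX).stronglyMeasurable (fun ω => (Real.exp_pos (X ω)).le) hbd hA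
    hdrift
  simp only [Function.comp_apply] at key
  have hXi : Integrable (fun ω => Real.exp (X ω)) P :=
    .of_bound hX'.exp.aestronglyMeasurable (Real.exp b) (by simpa using hXb)
  have hXAi : Integrable (fun ω => Real.exp (X ω) * A.indicator (fun _ => (1 : ℝ)) ω) P :=
    hXi.mul_bdd (c := 1) (measurable_const.indicator hA).aestronglyMeasurable
      (.of_forall fun ω => by by_cases h : ω ∈ A <;> simp [h])
  have hYi : Integrable (fun ω => Real.exp (Y ω)) P := by
    refine .of_bound hY.exp.aestronglyMeasurable (Real.exp (b + a)) ?_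
    filter_upwards [hXb, hYX] with ω h₁ h₂
    simpa using by linarith
  calc ∫ ω, Real.exp (Y ω) ∂P
      ≤ ∫ ω, (Real.exp (-e) + Real.exp a) * Real.exp (X ω) -
          Real.exp a * (Real.exp (X ω) * A.indicator (fun _ => (1 : ℝ)) ω) ∂P := by
        refine integral_mono_ae hYi ((hXi.const_mul _).sub (hXAi.const_mul _)) ?_
        filter_upwards [hYX] with ω h
        by_cases hω : ω ∈ A
        · have := Real.exp_le_exp.2 (show Y ω ≤ -e + X ω by
            have : Y ω ≤ X ω - e := hω
            linarith)
          rw [Real.exp_add] at this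
          simp only [hω, Set.indicator_of_mem]
          linarith
        · have := Real.exp_le_exp.2 h
          rw [Real.exp_add] at this
          simp only [hω, not_false_eq_true, Set.indicator_of_notMem]
          linarith [mul_pos (Real.exp_pos (-e)) (Real.exp_pos (X ω))]
    _ = (Real.exp (-e) + Real.exp a) * ∫ ω, Real.exp (X ω) ∂P -
          Real.exp a * ∫ ω, Real.exp (X ω) * A.indicator (fun _ => (1 : ℝ)) ω ∂P := by
        rw [integral_sub (hXi.const_mul _) (hXAi.const_mul _), integral_const_mul,
          integral_const_mul]
    _ ≤ _ := by linarith [mul_le_mul_of_nonneg_left key (Real.exp_pos a).le]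

/-- Adapted processes with bounded up-steps that go down by `e` with conditional probability at
least `1 - ρ` have geometrically decaying exponential moments. -/
theorem lintegral_exp_le_of_condExp_drift {Ω : Type*} {mΩ : MeasurableSpace Ω}
    {P : Measure Ω} [IsProbabilityMeasure P] {ℱ : Filtration ℕ mΩ} {D : ℕ → Ω → ℝ}
    (hD : Adapted ℱ D) {s a e ρ : ℝ} (hρ : 0 ≤ ρ) (h0 : ∀ᵐ ω ∂P, D 0 ω = s)
    (hup : ∀ n, ∀ᵐ ω ∂P, D (n + 1) ω ≤ D n ω + a)
    (hdrift : ∀ n, ∀ᵐ ω ∂P, 1 - ρ ≤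
      (P[{ω' | D (n + 1) ω' ≤ D n ω' - e}.indicator (fun _ => (1 : ℝ)) | ℱ n]) ω) (n : ℕ) :
    ∫⁻ ω, ENNReal.ofReal (Real.exp (D n ω)) ∂P ≤
      ENNReal.ofReal ((Real.exp (-e) + Real.exp a * ρ) ^ n * Real.exp s) := by
  have hmeas : ∀ n, Measurable (D n) := fun n => (hD n).mono (ℱ.le n) le_rfl
  have hbound : ∀ n : ℕ, ∀ᵐ ω ∂P, D n ω ≤ s + n * a := by
    intro n
    induction n with
    | zero => filter_upwards [h0] with ω h using by simp [h]
    | succ n ih =>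
      filter_upwards [ih, hup n] with ω h₁ h₂
      push_cast
      linarith
  have hint : ∫ ω, Real.exp (D n ω) ∂P ≤
      (Real.exp (-e) + Real.exp a * ρ) ^ n * Real.exp s := by
    induction n with
    | zero =>
      have : (fun ω => Real.exp (D 0 ω)) =ᵐ[P] fun _ => Real.exp s := by
        filter_upwards [h0] with ω h using by rw [h]
      simp [integral_congr_ae this]
    | succ n ih =>
      refine (integral_exp_le_of_condExp_drift (ℱ.le n) (hD n) (hmeas _) (hbound n) (hup n)
        (hdrift n)).trans ?_
      rw [pow_succ', mul_assoc]
      exact mul_le_mul_of_nonneg_left ih (by positivity)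
  have hi : Integrable (fun ω => Real.exp (D n ω)) P :=
    .of_bound (hmeas n).exp.aestronglyMeasurable (Real.exp (s + n * a))
      (by simpa using hbound n)
  rw [← ofReal_integral_eq_lintegral_ofReal hi (.of_forall fun ω => (Real.exp_pos _).le)]
  exact ENNReal.ofReal_le_ofReal hint

/-- Fix `λ ∈ (0,1)`, `Ψ = 2/(1−λ)`, `ε = (1−λ)λ/8`.  There exists
`ρ* > 0` such that the following holds.  Let `(D_n)` be an adapted process
satisfying the drift hypotheses with parameters `ρ ≤ ρ*`, `Ψ`, `ε` and starting
point `s` (i.e. `D_0 = s` a.s., `D_{n+1} ≤ D_n + Ψ` a.s., and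
`P(D_{n+1} ≤ D_n − ε | F_n) ≥ 1 − ρ` a.s.), let `γ = inf{n : D_n ≤ 0}`, let
`B_* > 0` and let `(T_n)_{n≥1}` be nonnegative random variables with
`T_n ≤ Ψ·B_*·e^{D_{n−1}}` a.s. for every `n ≥ 1`.  Then
`E[ Σ_{n=1}^{γ} T_n ] < ∞`; the random sum `Σ_{n=1}^{γ} T_n` is written as
`Σ_{n≥1} T_n · 1[n ≤ γ]`, where `n ≤ γ` is the event `∀ k < n, D_k > 0`. -/
theorem stmt14 (lam : ℝ) (hlam0 : 0 < lam) (hlam1 : lam < 1) :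
    ∃ ρstar > (0 : ℝ), ∀ ρ : ℝ, 0 ≤ ρ → ρ ≤ ρstar → ∀ s : ℝ,
    ∀ (Ω : Type) (mΩ : MeasurableSpace Ω) (P : Measure Ω),
      IsProbabilityMeasure P →
    ∀ (ℱ : Filtration ℕ mΩ) (D : ℕ → Ω → ℝ), Adapted ℱ D →
      (∀ᵐ ω ∂P, D 0 ω = s) →
      (∀ n : ℕ, ∀ᵐ ω ∂P, D (n + 1) ω ≤ D n ω + Psi lam) →
      (∀ n : ℕ, ∀ᵐ ω ∂P, 1 - ρ ≤
        (P[{ω' | D (n + 1) ω' ≤ D n ω' - eps lam}.indicator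
            (fun _ => (1 : ℝ)) | ℱ n]) ω) →
    ∀ Bstar : ℝ, 0 < Bstar →
    ∀ T : ℕ → Ω → ℝ, (∀ n, Measurable (T n)) → (∀ n ω, 0 ≤ T n ω) →
      (∀ n : ℕ, ∀ᵐ ω ∂P, T (n + 1) ω ≤ Psi lam * Bstar * Real.exp (D n ω)) →
      ∫⁻ ω, ∑' n : ℕ,
          {ω' | ∀ k ≤ n, 0 < D k ω'}.indicator
            (fun ω' => ENNReal.ofReal (T (n + 1) ω')) ω ∂P < ⊤ := by
  have hΨ : 0 < Psi lam := div_pos two_pos (by linarith)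
  have hε : 0 < eps lam := div_pos (mul_pos (by linarith) hlam0) (by norm_num)
  have hlt : Real.exp (-eps lam) < 1 := Real.exp_lt_one_iff.2 (by linarith)
  refine ⟨(1 - Real.exp (-eps lam)) / 2 * Real.exp (-Psi lam),
    mul_pos (by linarith) (Real.exp_pos _), ?_⟩
  intro ρ hρ0 hρ s Ω mΩ P hP ℱ D hD h0 hup hdrift Bstar hB T _ _ hTle
  set r := Real.exp (-eps lam) + Real.exp (Psi lam) * ρ
  have hr0 : 0 ≤ r := by positivity
  have hr1 : r < 1 := by
    have h := mul_le_mul_of_nonneg_left hρ (Real.exp_pos (Psi lam)).le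
    rw [mul_left_comm, ← Real.exp_add, add_neg_cancel, Real.exp_zero, mul_one] at h
    change Real.exp (-eps lam) + Real.exp (Psi lam) * ρ < 1
    linarith
  have hC : 0 ≤ Psi lam * Bstar := by positivity
  have hmeas : ∀ n, Measurable fun ω => ENNReal.ofReal (Real.exp (D n ω)) := fun n =>
    ((hD n).mono (ℱ.le n) le_rfl).exp.ennreal_ofReal
  calc _ ≤ ∫⁻ ω, ∑' n : ℕ,
        ENNReal.ofReal (Psi lam * Bstar) * ENNReal.ofReal (Real.exp (D n ω)) ∂P := by
        refine lintegral_mono_ae ?_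
        filter_upwards [ae_all_iff.2 hTle] with ω hω
        refine ENNReal.tsum_le_tsum fun n => (Set.indicator_le_self _ _ ω).trans ?_
        rw [← ENNReal.ofReal_mul hC]
        exact ENNReal.ofReal_le_ofReal (hω n)
    _ = ∑' n : ℕ, ENNReal.ofReal (Psi lam * Bstar) *
          ∫⁻ ω, ENNReal.ofReal (Real.exp (D n ω)) ∂P := by
        rw [lintegral_tsum fun n => ((hmeas n).const_mul _).aemeasurable]
        exact tsum_congr fun n => lintegral_const_mul _ (hmeas n)
    _ ≤ ∑' n : ℕ, ENNReal.ofReal (Psi lam * Bstar) *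
          ENNReal.ofReal (r ^ n * Real.exp s) :=
        ENNReal.tsum_le_tsum fun n => mul_le_mul_right
          (lintegral_exp_le_of_condExp_drift hD hρ0 h0 hup hdrift n) _
    _ < ⊤ := by
        rw [ENNReal.tsum_mul_left]
        exact ENNReal.mul_lt_top ENNReal.ofReal_lt_top
          ((summable_geometric_of_lt_one hr0 hr1).mul_right _).tsum_ofReal_lt_top
end
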